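/- Let n ≥ 3 and let f_i(x) = xᵀA_ix + 2b_iᵀx + c_i, i ∈ [m], define S = {x ∈ ℝⁿ : f_i(x) < 0 for all i ∈ [m]}. Assume S ≠ ∅, conv(S) ≠ ℝⁿ, and the homogeneous quadratic map f^h satisfies hidden hyperplane convexity. Let Ω_1 = Ω \ {λ ∈ Ω : S_λ = ℝⁿ}. Let λ ∈ Ω_1 and θ ∈ ℝᵐ with Q_θ = Σᵢ θ_iQ_i positive semidefinite, and suppose λ' = λ + θ satisfies λ' ≥ 0 and λ' ≠ 0. Then λ' ∈ Ω_1 and S_{λ'} ⊆ S_λ. -/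

import Mathlib

open Matrix Set

noncomputable section

/-- The value of the quadratic function `xᵀ A x + 2 bᵀ x + c`. -/
def qf {n : ℕ} (A : Matrix (Fin n) (Fin n) ℝ) (b : Fin n → ℝ) (c : ℝ) (x : Fin n → ℝ) : ℝ :=
  x ⬝ᵥ A.mulVec x + 2 * (b ⬝ᵥ x) + c

/-- The bordered `(n+1)×(n+1)` matrix `[[A, b], [bᵀ, c]]`. -/
def Qmat {n : ℕ} (A : Matrix (Fin n) (Fin n) ℝ) (b : Fin n → ℝ) (c : ℝ) :
    Matrix (Fin n ⊕ Unit) (Fin n ⊕ Unit) ℝ :=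
  Matrix.fromBlocks A (Matrix.of fun i _ => b i) (Matrix.of fun _ j => b j)
    (Matrix.of fun _ _ => c)

/-- A linear hyperplane: the kernel of a nonzero linear functional. -/
def IsLinearHyperplane {V : Type*} [AddCommGroup V] [Module ℝ V] (H : Submodule ℝ V) : Prop :=
  ∃ φ : V →ₗ[ℝ] ℝ, φ ≠ 0 ∧ H = LinearMap.ker φ

/-- Image of a set under the quadratic map associated to the family `Q`. -/
def quadImage {ι κ : Type*} [Fintype ι] (Q : κ → Matrix ι ι ℝ) (U : Set (ι → ℝ)) :
    Set (κ → ℝ) :=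
  (fun x k => x ⬝ᵥ (Q k).mulVec x) '' U

/-- Hidden hyperplane convexity: the image of every linear hyperplane under the
quadratic map is convex. -/
def HHC {ι κ : Type*} [Fintype ι] (Q : κ → Matrix ι ι ℝ) : Prop :=
  ∀ H : Submodule ℝ (ι → ℝ), IsLinearHyperplane H →
    Convex ℝ (quadImage Q (H : Set (ι → ℝ)))

/-- `Q` has at most one negative eigenvalue, counted with multiplicity. -/
def NegEigsAtMostOne {ι : Type*} [Fintype ι] [DecidableEq ι] (Q : Matrix ι ι ℝ) : Prop :=
  ∃ hQ : Q.IsHermitian, (Finset.univ.filter fun i => hQ.eigenvalues i < 0).card ≤ 1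

/-- The set `S` defined by the strict quadratic inequalities. -/
def Sset {n m : ℕ} (A : Fin m → Matrix (Fin n) (Fin n) ℝ) (b : Fin m → Fin n → ℝ)
    (c : Fin m → ℝ) : Set (Fin n → ℝ) :=
  {x | ∀ i, qf (A i) (b i) (c i) x < 0}

/-- The set defined by the aggregated inequality with weights `lam`. -/
def Sagg {n m : ℕ} (A : Fin m → Matrix (Fin n) (Fin n) ℝ) (b : Fin m → Fin n → ℝ)
    (c : Fin m → ℝ) (lam : Fin m → ℝ) : Set (Fin n → ℝ) :=
  {x | ∑ i, lam i * qf (A i) (b i) (c i) x < 0}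

/-- The set `Ω` of good aggregations. -/
def Omega {n m : ℕ} (A : Fin m → Matrix (Fin n) (Fin n) ℝ) (b : Fin m → Fin n → ℝ)
    (c : Fin m → ℝ) : Set (Fin m → ℝ) :=
  {lam | 0 ≤ lam ∧ lam ≠ 0 ∧ convexHull ℝ (Sset A b c) ⊆ Sagg A b c lam ∧
    NegEigsAtMostOne (∑ i, lam i • Qmat (A i) (b i) (c i))}


/-- `Ω₁`: good aggregations whose aggregated set is not all of `ℝⁿ`. -/
def Omega1 {n m : ℕ} (A : Fin m → Matrix (Fin n) (Fin n) ℝ) (b : Fin m → Fin n → ℝ)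
    (c : Fin m → ℝ) : Set (Fin m → ℝ) :=
  {lam ∈ Omega A b c | Sagg A b c lam ≠ Set.univ}

/-- A bilinear form that is nonnegative on the kernel of some linear functional, i.e. whose
negative index of inertia is at most one. -/
def NonnegOnHyperplane {V : Type*} [AddCommGroup V] [Module ℝ V]
    (B : LinearMap.BilinForm ℝ V) : Prop :=
  ∃ φ : V →ₗ[ℝ] ℝ, ∀ v, φ v = 0 → 0 ≤ B v v

section BilinForm

variable {V : Type*} [AddCommGroup V] [Module ℝ V] {B B' : LinearMap.BilinForm ℝ V}

theorem bilin_smul_add_smul (hB : ∀ v w, B v w = B w v) (a b : ℝ) (v w : V) :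
    B (a • v + b • w) (a • v + b • w) =
      a ^ 2 * B v v + b ^ 2 * B w w + 2 * a * b * B v w := by
  simp only [map_add, map_smul, LinearMap.add_apply, LinearMap.smul_apply, smul_eq_mul, hB w v]
  ring

theorem NonnegOnHyperplane.nonneg_of_orthogonal (hN : NonnegOnHyperplane B)
    (hB : ∀ v w, B v w = B w v) {z s : V} (hz : B z z < 0) (hzs : B z s = 0) : 0 ≤ B s s := by
  obtain ⟨φ, hφ⟩ := hN
  by_contra! hs
  have h := hφ (φ s • z + (-φ z) • s) (by simp; ring)
  rw [bilin_smul_add_smul hB, hzs] at h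
  have hz0 : φ z ≠ 0 := fun h0 => absurd (hφ z h0) (not_le.mpr hz)
  have : 0 < φ z ^ 2 := by positivity
  nlinarith [sq_nonneg (φ s), mul_pos this (neg_pos.mpr hs),
    mul_nonneg (sq_nonneg (φ s)) (neg_pos.mpr hz).le]

theorem NonnegOnHyperplane.neg_of_same_side (hN : NonnegOnHyperplane B)
    (hB : ∀ v w, B v w = B w v) {z v w : V} (hz : B z z < 0) (hv : B v v < 0) (hw : B w w < 0)
    (hzv : B z v < 0) (hzw : B z w < 0) : B v w < 0 := by
  have h := hN.nonneg_of_orthogonal hB (s := B z w • v + (-B z v) • w) hz (by simp; ring)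
  rw [bilin_smul_add_smul hB] at h
  by_contra! hvw
  nlinarith [mul_pos (pow_pos (neg_pos.mpr hzw) 2) (neg_pos.mpr hv),
    mul_pos (pow_pos (neg_pos.mpr hzv) 2) (neg_pos.mpr hw),
    mul_nonneg (mul_pos (neg_pos.mpr hzw) (neg_pos.mpr hzv)).le hvw]

/-- Each of the two cones in which such a form is negative is convex. -/
theorem NonnegOnHyperplane.convex_cone (hN : NonnegOnHyperplane B)
    (hB : ∀ v w, B v w = B w v) {z : V} (hz : B z z < 0) :
    Convex ℝ {v | B v v < 0 ∧ B z v < 0} := by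
  rintro v ⟨hv, hzv⟩ w ⟨hw, hzw⟩ a b ha hb hab
  have hvw := hN.neg_of_same_side hB hz hv hw hzv hzw
  rcases ha.eq_or_lt with rfl | ha
  · obtain rfl : b = 1 := by linarith
    simpa using ⟨hw, hzw⟩
  · refine ⟨?_, ?_⟩
    · rw [bilin_smul_add_smul hB]
      nlinarith [mul_pos (pow_pos ha 2) (neg_pos.mpr hv),
        mul_nonneg (sq_nonneg b) (neg_pos.mpr hw).le,
        mul_nonneg (mul_nonneg ha.le hb) (neg_pos.mpr hvw).le]
    · simp only [map_add, map_smul, smul_eq_mul]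
      nlinarith [mul_pos ha (neg_pos.mpr hzv), mul_nonneg hb (neg_pos.mpr hzw).le]

/-- Points joined by a segment on which the form is negative lie in the same cone. -/
theorem NonnegOnHyperplane.neg_of_segment (hN : NonnegOnHyperplane B)
    (hB : ∀ v w, B v w = B w v) {z w : V}
    (hseg : ∀ v ∈ segment ℝ z w, B v v < 0) : B z w < 0 := by
  have hz := hseg z (left_mem_segment ℝ z w)
  by_contra! hzw
  have hd : 0 < B z w - B z z := by linarith
  refine absurd (hN.nonneg_of_orthogonal hB
    (s := (B z w / (B z w - B z z)) • z + (-B z z / (B z w - B z z)) • w) hz ?_) (not_le.mpr ?_)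
  · simp only [map_add, map_smul, smul_eq_mul]
    field_simp
    ring
  · exact hseg _ ⟨_, _, by positivity, div_nonneg (by linarith) hd.le,
      by field_simp; ring, rfl⟩

/-- If `B ≤ B'`, points negative for `B'` in the same cone of `B` are in the same cone of `B'`. -/
theorem NonnegOnHyperplane.neg_of_le (hN : NonnegOnHyperplane B)
    (hB : ∀ v w, B v w = B w v) (hB' : ∀ v w, B' v w = B' w v) (hle : ∀ v, B v v ≤ B' v v)
    {z w : V} (hz : B' z z < 0) (hw : B' w w < 0) (hzw : B z w < 0) : B' z w < 0 := by
  have hz0 : B z z < 0 := (hle z).trans_lt hz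
  have h := (hN.nonneg_of_orthogonal hB (s := B z w • z + (-B z z) • w) hz0
    (by simp; ring)).trans (hle _)
  rw [bilin_smul_add_smul hB'] at h
  by_contra! h'
  nlinarith [mul_pos (pow_pos (neg_pos.mpr hzw) 2) (neg_pos.mpr hz),
    mul_pos (pow_pos (neg_pos.mpr hz0) 2) (neg_pos.mpr hw),
    mul_nonneg (mul_pos (neg_pos.mpr hzw) (neg_pos.mpr hz0)).le h']

theorem NonnegOnHyperplane.mono (hN : NonnegOnHyperplane B) (hle : ∀ v, B v v ≤ B' v v) :
    NonnegOnHyperplane B' :=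
  let ⟨φ, hφ⟩ := hN
  ⟨φ, fun v hv => (hφ v hv).trans (hle v)⟩

end BilinForm

section Matrix

variable {ι : Type*} [Fintype ι] [DecidableEq ι] {Q : Matrix ι ι ℝ}

theorem toBilin'_comm_of_isHermitian (hQ : Q.IsHermitian) (v w : ι → ℝ) :
    Matrix.toBilin' Q v w = Matrix.toBilin' Q w v := by
  have h : Qᵀ = Q := by simpa [Matrix.IsHermitian] using hQ
  rw [Matrix.toBilin'_apply', Matrix.toBilin'_apply', Matrix.dotProduct_mulVec,
    ← Matrix.mulVec_transpose, h, dotProduct_comm]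

theorem toBilin'_eigenvectorBasis (hQ : Q.IsHermitian) (v : ι → ℝ) (i : ι) :
    Matrix.toBilin' Q v (hQ.eigenvectorBasis i) =
      hQ.eigenvalues i * (v ⬝ᵥ ⇑(hQ.eigenvectorBasis i)) := by
  rw [Matrix.toBilin'_apply', hQ.mulVec_eigenvectorBasis, dotProduct_smul, smul_eq_mul]

theorem eigenvectorBasis_dotProduct (hQ : Q.IsHermitian) (i j : ι) :
    ⇑(hQ.eigenvectorBasis i) ⬝ᵥ ⇑(hQ.eigenvectorBasis j) = if i = j then 1 else 0 := by
  rw [← orthonormal_iff_ite.mp hQ.eigenvectorBasis.orthonormal i j,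
    EuclideanSpace.inner_eq_star_dotProduct, dotProduct_comm]
  simp

theorem toBilin'_self_eq_sum_eigenvalues (hQ : Q.IsHermitian) (v : ι → ℝ) :
    Matrix.toBilin' Q v v =
      ∑ i, hQ.eigenvalues i * (v ⬝ᵥ ⇑(hQ.eigenvectorBasis i)) ^ 2 := by
  have hv : v = ∑ i, (v ⬝ᵥ ⇑(hQ.eigenvectorBasis i)) • ⇑(hQ.eigenvectorBasis i) := by
    have h := congrArg (WithLp.ofLp) (hQ.eigenvectorBasis.sum_repr' (WithLp.toLp 2 v))
    simpa [EuclideanSpace.inner_eq_star_dotProduct] using h.symm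
  conv_lhs => enter [2]; rw [hv]
  simp only [map_sum, map_smul, toBilin'_eigenvectorBasis, smul_eq_mul]
  exact Finset.sum_congr rfl fun i _ => by ring

theorem negEigsAtMostOne_iff (hQ : Q.IsHermitian) :
    NegEigsAtMostOne Q ↔ NonnegOnHyperplane (Matrix.toBilin' Q) := by
  constructor
  · rintro ⟨_, hcard⟩
    rw [Finset.card_le_one] at hcard
    by_cases hex : ∃ i, hQ.eigenvalues i < 0
    · obtain ⟨i, hi⟩ := hex
      refine ⟨Matrix.toBilin' (1 : Matrix ι ι ℝ) (hQ.eigenvectorBasis i), fun v hv => ?_⟩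
      rw [Matrix.toBilin'_apply', Matrix.one_mulVec, dotProduct_comm] at hv
      rw [toBilin'_self_eq_sum_eigenvalues hQ]
      refine Finset.sum_nonneg fun j _ => ?_
      by_cases hj : hQ.eigenvalues j < 0
      · obtain rfl := hcard i (by simpa using hi) j (by simpa using hj)
        simp [hv]
      · exact mul_nonneg (not_lt.mp hj) (sq_nonneg _)
    · push Not at hex
      refine ⟨0, fun v _ => ?_⟩
      rw [toBilin'_self_eq_sum_eigenvalues hQ]
      exact Finset.sum_nonneg fun j _ => mul_nonneg (hex j) (sq_nonneg _)
  · intro hN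
    refine ⟨hQ, Finset.card_le_one.mpr fun i hi j hj => ?_⟩
    simp only [Finset.mem_filter, Finset.mem_univ, true_and] at hi hj
    by_contra hij
    refine absurd (hN.nonneg_of_orthogonal (toBilin'_comm_of_isHermitian hQ)
      (z := hQ.eigenvectorBasis i) (s := hQ.eigenvectorBasis j) ?_ ?_) (not_le.mpr ?_) <;>
    simp [toBilin'_eigenvectorBasis, eigenvectorBasis_dotProduct, hi, hj, hij]

end Matrix

/-- The embedding `x ↦ (x, 1)` into homogeneous coordinates. -/
def homog {n : ℕ} (x : Fin n → ℝ) : Fin n ⊕ Unit → ℝ :=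
  Sum.elim x 1

theorem homog_combo {n : ℕ} {a b : ℝ} (hab : a + b = 1) (x y : Fin n → ℝ) :
    homog (a • x + b • y) = a • homog x + b • homog y := by
  ext (i | i) <;> simp [homog, hab]

theorem toBilin'_Qmat_homog {n : ℕ} (A : Matrix (Fin n) (Fin n) ℝ) (b : Fin n → ℝ) (c : ℝ)
    (x : Fin n → ℝ) : Matrix.toBilin' (Qmat A b c) (homog x) (homog x) = qf A b c x := by
  rw [Matrix.toBilin'_apply', homog, Qmat, Matrix.fromBlocks_mulVec, sumElim_dotProduct_sumElim,
    dotProduct_add]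
  simp [qf, dotProduct, Matrix.mulVec, mul_comm]
  ring

theorem toBilin'_sum_Qmat_homog {n m : ℕ} (A : Fin m → Matrix (Fin n) (Fin n) ℝ)
    (b : Fin m → Fin n → ℝ) (c : Fin m → ℝ) (lam : Fin m → ℝ) (x : Fin n → ℝ) :
    Matrix.toBilin' (∑ i, lam i • Qmat (A i) (b i) (c i)) (homog x) (homog x) =
      ∑ i, lam i * qf (A i) (b i) (c i) x := by
  simp [toBilin'_Qmat_homog]

/-- Improving a good aggregation by a PSD combination: if `λ ∈ Ω₁`, `Q_θ` is PSD and
`λ' = λ + θ` is nonnegative and nonzero, then `λ' ∈ Ω₁` and `S_{λ'} ⊆ S_λ`. -/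
theorem statement19 (n m : ℕ) (hn : 3 ≤ n)
    (A : Fin m → Matrix (Fin n) (Fin n) ℝ) (b : Fin m → Fin n → ℝ) (c : Fin m → ℝ)
    (hsymm : ∀ i, (A i).IsSymm)
    (hHHC : HHC fun i => Qmat (A i) (b i) (c i))
    (hS : (Sset A b c).Nonempty)
    (hconv : convexHull ℝ (Sset A b c) ≠ Set.univ)
    (lam θ : Fin m → ℝ)
    (hlam : lam ∈ Omega1 A b c)
    (hθ : (∑ i, θ i • Qmat (A i) (b i) (c i)).PosSemidef)
    (hge : 0 ≤ lam + θ) (hne : lam + θ ≠ 0) :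
    (lam + θ) ∈ Omega1 A b c ∧ Sagg A b c (lam + θ) ⊆ Sagg A b c lam := by
  obtain ⟨⟨-, -, hhull, hneg⟩, huniv⟩ := hlam
  obtain ⟨x₀, hx₀⟩ := hS
  have hQ := hneg.1
  have hsum : ∑ i, (lam + θ) i • Qmat (A i) (b i) (c i) =
      ∑ i, lam i • Qmat (A i) (b i) (c i) + ∑ i, θ i • Qmat (A i) (b i) (c i) := by
    simp [add_smul, Finset.sum_add_distrib]
  have hQ' : (∑ i, (lam + θ) i • Qmat (A i) (b i) (c i)).IsHermitian := by
    rw [hsum]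
    exact hQ.add hθ.1
  have hle : ∀ v, Matrix.toBilin' (∑ i, lam i • Qmat (A i) (b i) (c i)) v v ≤
      Matrix.toBilin' (∑ i, (lam + θ) i • Qmat (A i) (b i) (c i)) v v := by
    intro v
    rw [hsum, map_add, LinearMap.add_apply, LinearMap.add_apply, le_add_iff_nonneg_right,
      Matrix.toBilin'_apply']
    simpa using hθ.dotProduct_mulVec_nonneg v
  have hagg := toBilin'_sum_Qmat_homog A b c
  have hB := toBilin'_comm_of_isHermitian hQ
  have hB' := toBilin'_comm_of_isHermitian hQ'
  have hN := (negEigsAtMostOne_iff hQ).mp hneg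
  have hN' := hN.mono hle
  have hsub : Sagg A b c (lam + θ) ⊆ Sagg A b c lam := by
    intro x hx
    have h := hle (homog x)
    rw [hagg, hagg] at h
    exact h.trans_lt hx
  have hS' : ∀ x ∈ Sset A b c, Matrix.toBilin' (∑ i, (lam + θ) i • Qmat (A i) (b i) (c i))
      (homog x) (homog x) < 0 := by
    intro x hx
    rw [hagg]
    obtain ⟨i, hi⟩ := Function.ne_iff.mp hne
    exact Finset.sum_neg' (fun j _ => mul_nonpos_of_nonneg_of_nonpos (hge j) (hx j).le)
      ⟨i, Finset.mem_univ i, mul_neg_of_pos_of_neg (lt_of_le_of_ne (hge i) (Ne.symm hi)) (hx i)⟩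
  refine ⟨⟨⟨hge, hne, fun x hx => ?_, (negEigsAtMostOne_iff hQ').mpr hN'⟩,
    fun h => huniv (univ_subset_iff.mp (h ▸ hsub))⟩, hsub⟩
  have hcone := hN'.convex_cone hB' (hS' x₀ hx₀)
  have hpre : Convex ℝ (homog ⁻¹' _) := fun y hy z hz s t hs ht hst => by
    rw [mem_preimage, homog_combo hst]
    exact hcone hy hz hs ht hst
  have hmem := convexHull_min (fun y hy => ?_) hpre hx
  · have h := hmem.1
    rwa [hagg] at h
  · refine ⟨hS' y hy, hN.neg_of_le hB hB' hle (hS' x₀ hx₀) (hS' y hy) (hN.neg_of_segment hB ?_)⟩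
    rintro _ ⟨s, t, hs, ht, hst, rfl⟩
    rw [← homog_combo hst, hagg]
    exact hhull (convex_convexHull ℝ _ (subset_convexHull ℝ _ hx₀) (subset_convexHull ℝ _ hy)
      hs ht hst)

end
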